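/- arXiv:2502.20700 — 7 statements merged into one kernel-verified Lean document; each statement's English description precedes it below -/
import Mathlib

section
/- Let c_0 > 0 and λ ∈ (0,1) satisfy ‖A^k‖ ≤ c_0 λ^k for all k ∈ ℕ. Let (y_k)_{k∈ℤ} and (y'_k)_{k∈ℤ} be real sequences with y_k = y'_k = 0 for k ≤ 0, and suppose there is T_1 ≥ 1 such that for every k ≥ T_1, y_{k+1} − ∑_{j=1}^p a_j y_{k+1−j} = y'_{k+1} − ∑_{j=1}^p a_j y'_{k+1−j} (the two sequences satisfy the same recursion with identical forcing from time T_1 on). If ∑_{k=1}^{T_1} |y_k − y'_k| ≤ δ for some δ > 0, then for every T_2 ≥ T_1, ∑_{k=1}^{T_2} |y_k − y'_k| ≤ (1 + √p · c_0 λ/(1−λ)) · δ. -/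
/-- The companion matrix of coefficients `a = (a_1, …, a_p)` (0-indexed: `a i = a_{i+1}`). -/
def companionMatrix {p : ℕ} (a : Fin p → ℝ) : Matrix (Fin p) (Fin p) ℝ :=
  Matrix.of fun i j =>
    if (i : ℕ) = p - 1 then a (Fin.rev j)
    else if (j : ℕ) = (i : ℕ) + 1 then 1 else 0

/-- The operator norm of a real `p × p` matrix, induced by the Euclidean norm. -/
noncomputable def euclideanOpNorm {p : ℕ} (M : Matrix (Fin p) (Fin p) ℝ) : ℝ :=
  ‖Matrix.toEuclideanCLM (𝕜 := ℝ) M‖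

theorem window_sum_le (f : ℤ → ℝ) (hf : ∀ k, 0 ≤ f k) (h0 : ∀ k : ℤ, k ≤ 0 → f k = 0) (n : ℕ) :
    ∀ p : ℕ, ∑ i ∈ Finset.range p, f ((n : ℤ) - (i : ℤ)) ≤ ∑ k ∈ Finset.Icc 1 n, f (k : ℤ) := by
  induction n with
  | zero =>
    intro p
    simp only [Nat.cast_zero]
    rw [Finset.sum_eq_zero (fun i _ => h0 _ (by omega))]
    simp
  | succ n ih =>
    intro p
    rw [Finset.sum_Icc_succ_top (by omega)]
    cases p with
    | zero =>
      simp only [Finset.range_zero, Finset.sum_empty]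
      exact add_nonneg (Finset.sum_nonneg fun _ _ => hf _) (hf _)
    | succ p =>
      rw [Finset.sum_range_succ']
      have := ih p
      have e : ∀ i : ℕ, ((n + 1 : ℕ) : ℤ) - ((i + 1 : ℕ) : ℤ) = (n : ℤ) - i := by
        intro i; push_cast; ring
      simp only [e]
      simpa using this

theorem euclid_norm_le_sum {p : ℕ} (v : EuclideanSpace ℝ (Fin p)) : ‖v‖ ≤ ∑ i, |v i| := by
  rw [EuclideanSpace.norm_eq]
  apply Real.sqrt_le_iff.2
  refine ⟨Finset.sum_nonneg fun _ _ => abs_nonneg _, ?_⟩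
  simp only [Real.norm_eq_abs]
  exact Finset.sum_sq_le_sq_sum_of_nonneg fun _ _ => abs_nonneg _

theorem companion_step {p : ℕ} (hp : 1 ≤ p) (a : Fin p → ℝ) (e : ℤ → ℝ) (k : ℤ)
    (h : e (k + 1) = ∑ j : Fin p, a j * e (k - (j : ℕ))) :
    (companionMatrix a).mulVec (fun i : Fin p => e (k - (p : ℤ) + 1 + (i : ℕ))) =
      fun i : Fin p => e (k + 1 - (p : ℤ) + 1 + (i : ℕ)) := by
  funext i
  simp only [Matrix.mulVec, dotProduct, companionMatrix, Matrix.of_apply]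
  by_cases hi : (i : ℕ) = p - 1
  · simp only [hi, if_true]
    have : k + 1 - (p : ℤ) + 1 + ((p - 1 : ℕ) : ℤ) = k + 1 := by omega
    rw [this, h, ← Equiv.sum_comp Fin.revPerm]
    refine Finset.sum_congr rfl fun j _ => ?_
    have hj := j.2
    simp only [Fin.revPerm_apply, Fin.rev_rev, Fin.val_rev]
    congr 2
    omega
  · simp only [hi, if_false]
    have hi' := i.2
    rw [Finset.sum_eq_single (⟨i + 1, by omega⟩ : Fin p)]
    · simp only [if_true, one_mul]
      congr 1
      push_cast
      ring
    · intro j _ hj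
      rw [if_neg, zero_mul]
      intro h'
      exact hj (Fin.ext h')
    · simp

/-- If `‖A^k‖ ≤ c₀ l^k` for all `k`, where `A` is the companion matrix, and two sequences
`y, y'` (vanishing for `k ≤ 0`) satisfy the same AR(p) recursion with identical forcing from
time `T₁` on and `∑_{k=1}^{T₁} |y_k − y'_k| ≤ δ`, then for every `T₂ ≥ T₁`,
`∑_{k=1}^{T₂} |y_k − y'_k| ≤ (1 + √p c₀ l/(1−l)) δ`. -/
theorem stmt1 (p : ℕ) (hp : 1 ≤ p) (a : Fin p → ℝ) (c₀ l : ℝ)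
    (hc₀ : 0 < c₀) (hl : l ∈ Set.Ioo (0 : ℝ) 1)
    (hA : ∀ k : ℕ, euclideanOpNorm ((companionMatrix a) ^ k) ≤ c₀ * l ^ k)
    (y y' : ℤ → ℝ) (hy0 : ∀ k : ℤ, k ≤ 0 → y k = 0) (hy'0 : ∀ k : ℤ, k ≤ 0 → y' k = 0)
    (T₁ : ℕ) (hT₁ : 1 ≤ T₁) (δ : ℝ) (hδ : 0 < δ)
    (hrec : ∀ k : ℤ, (T₁ : ℤ) ≤ k →
      y (k + 1) - ∑ j : Fin p, a j * y (k - (j : ℕ)) =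
        y' (k + 1) - ∑ j : Fin p, a j * y' (k - (j : ℕ)))
    (hadj : ∑ k ∈ Finset.Icc 1 T₁, |y (k : ℤ) - y' (k : ℤ)| ≤ δ) :
    ∀ T₂ : ℕ, T₁ ≤ T₂ →
      ∑ k ∈ Finset.Icc 1 T₂, |y (k : ℤ) - y' (k : ℤ)| ≤
        (1 + Real.sqrt p * c₀ * l / (1 - l)) * δ := by
  obtain ⟨hl0, hl1⟩ := hl
  set e : ℤ → ℝ := fun k => y k - y' k with he
  have hrec' : ∀ k : ℤ, (T₁ : ℤ) ≤ k → e (k + 1) = ∑ j : Fin p, a j * e (k - (j : ℕ)) := by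
    intro k hk
    have := hrec k hk
    simp only [he, mul_sub, Finset.sum_sub_distrib]
    linarith
  have hpow : ∀ n : ℕ, ((companionMatrix a) ^ n).mulVec
      (fun i : Fin p => e ((T₁ : ℤ) - (p : ℤ) + 1 + (i : ℕ))) =
      fun i : Fin p => e ((T₁ : ℤ) + n - (p : ℤ) + 1 + (i : ℕ)) := by
    intro n
    induction n with
    | zero => simp
    | succ n ih =>
      rw [pow_succ', ← Matrix.mulVec_mulVec, ih, companion_step hp a e _ (hrec' _ (by omega))]
      funext i
      congr 1
  set v : EuclideanSpace ℝ (Fin p) :=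
    WithLp.toLp 2 (fun i : Fin p => e ((T₁ : ℤ) - (p : ℤ) + 1 + (i : ℕ))) with hv
  have hvn : ‖v‖ ≤ δ := by
    refine (euclid_norm_le_sum v).trans (le_trans ?_ hadj)
    refine le_trans (le_of_eq ?_) (window_sum_le (fun k => |e k|) (fun _ => abs_nonneg _) ?_ T₁ p)
    · rw [← Fin.sum_univ_eq_sum_range (fun i : ℕ => |e ((T₁ : ℤ) - (i : ℤ))|) p,
        ← Equiv.sum_comp Fin.revPerm]
      refine Finset.sum_congr rfl fun j _ => ?_
      have hj := j.2
      simp only [hv, Fin.revPerm_apply, Fin.val_rev]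
      congr 2
      omega
    · intro k hk
      simp [he, hy0 k hk, hy'0 k hk]
  have hb : ∀ n : ℕ, |e ((T₁ : ℤ) + n)| ≤ c₀ * l ^ n * δ := by
    intro n
    set w := Matrix.toEuclideanCLM (𝕜 := ℝ) ((companionMatrix a) ^ n) v with hw
    have h1 : ‖w‖ ≤ c₀ * l ^ n * δ := by
      refine (ContinuousLinearMap.le_opNorm _ _).trans ?_
      exact mul_le_mul (hA n) hvn (norm_nonneg _) (by positivity)
    have h2 : w ⟨p - 1, by omega⟩ = e ((T₁ : ℤ) + n) := by
      have : w = WithLp.toLp 2 (((companionMatrix a) ^ n).mulVec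
        (fun i : Fin p => e ((T₁ : ℤ) - (p : ℤ) + 1 + (i : ℕ)))) := by
        rw [hw, hv, Matrix.toEuclideanCLM_toLp]
      rw [this, hpow n]
      show e _ = e _
      congr 1
      simp only
      omega
    rw [← h2, ← Real.norm_eq_abs]
    exact (PiLp.norm_apply_le w _).trans h1
  have hsum : ∀ n : ℕ, ∑ k ∈ Finset.Icc 1 (T₁ + n), |e (k : ℤ)| ≤
      δ + c₀ * δ * (l * (1 - l ^ n) / (1 - l)) := by
    intro n
    have h1l : (1 - l) ≠ 0 := by linarith
    induction n with
    | zero => simpa using hadj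
    | succ n ih =>
      rw [← add_assoc, Finset.sum_Icc_succ_top (by omega)]
      have h := hb (n + 1)
      have e1 : ((T₁ + n + 1 : ℕ) : ℤ) = (T₁ : ℤ) + ((n + 1 : ℕ) : ℤ) := by push_cast; ring
      rw [e1]
      have e2 : δ + c₀ * δ * (l * (1 - l ^ (n + 1)) / (1 - l)) =
          δ + c₀ * δ * (l * (1 - l ^ n) / (1 - l)) + c₀ * l ^ (n + 1) * δ := by
        field_simp
        ring
      rw [e2]
      exact add_le_add ih h
  intro T₂ hT
  obtain ⟨n, rfl⟩ := Nat.exists_eq_add_of_le hT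
  refine (hsum n).trans ?_
  have hs : 1 ≤ Real.sqrt p := Real.one_le_sqrt.2 (by exact_mod_cast hp)
  have h1l : 0 < 1 - l := by linarith
  have hq : l * (1 - l ^ n) / (1 - l) ≤ l / (1 - l) := by
    apply div_le_div_of_nonneg_right _ h1l.le
    have : 0 ≤ l * l ^ n := by positivity
    linarith
  have hX : 0 ≤ c₀ * δ * (l / (1 - l)) := by positivity
  calc δ + c₀ * δ * (l * (1 - l ^ n) / (1 - l)) ≤ δ + c₀ * δ * (l / (1 - l)) := by gcongr
    _ ≤ δ + Real.sqrt p * (c₀ * δ * (l / (1 - l))) := by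
        have := le_mul_of_one_le_left hX hs
        linarith
    _ = _ := by ring
end

section
/- Let c_0 > 0 and λ ∈ (0,1) satisfy ‖A^k‖ ≤ c_0 λ^k for all k ∈ ℕ. Let q ≥ 1, b_1, …, b_q ∈ ℝ, k_0 ≥ 0, δ > 0, and let (u_k)_{k∈ℤ} be a real sequence with u_k = 0 for every k ≠ k_0 and |u_{k_0}| ≤ δ. Let (y_k)_{k∈ℤ} satisfy y_k = 0 for all k ≤ k_0 and y_{k+1} = ∑_{j=1}^p a_j y_{k+1−j} + ∑_{j=1}^{q} b_j u_{k+1−j} for all k ≥ k_0. Then for every T > 0, ∑_{k=1}^{T} |y_k| ≤ (1 + √p · c_0 λ/(1−λ)) · (∑_{j=1}^{q} |b_j|) · δ. -/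
theorem aux_state (P : ℕ) (a : Fin (P+1) → ℝ) (y : ℤ → ℝ) (w : ℕ → ℝ)
    (hy0 : ∀ k : ℤ, k ≤ 0 → y k = 0)
    (hrec : ∀ n : ℕ, y ((n : ℤ) + 1) = (∑ j : Fin (P+1), a j * y ((n : ℤ) - (j : ℕ))) + w n) (n : ℕ) :
    (fun i : Fin (P+1) => y ((n : ℤ) - P + (i : ℕ))) =
      ∑ s ∈ Finset.range n, w s • ((companionMatrix a) ^ (n - 1 - s)).mulVec
        (Pi.single (Fin.last P) 1) := by
  induction n with
  | zero =>
    funext i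
    have := i.2
    simp
    apply hy0
    omega
  | succ n ih =>
    have step : (fun i : Fin (P+1) => y (((n+1 : ℕ) : ℤ) - P + (i : ℕ))) =
        (companionMatrix a).mulVec (fun i : Fin (P+1) => y ((n : ℤ) - P + (i : ℕ)))
          + w n • (Pi.single (Fin.last P) 1) := by
      funext i
      simp only [Pi.add_apply, Pi.smul_apply, Matrix.mulVec, dotProduct, companionMatrix,
        Matrix.of_apply, smul_eq_mul]
      by_cases hi : i = Fin.last P
      · subst hi
        simp only [Fin.val_last, Nat.add_sub_cancel, if_true, Pi.single_eq_same, mul_one]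
        rw [← Equiv.sum_comp Fin.revPerm]
        have e1 : (((n+1 : ℕ) : ℤ) - P + (P : ℕ)) = (n : ℤ) + 1 := by push_cast; ring
        rw [e1, hrec n]
        congr 1
        apply Finset.sum_congr rfl
        intro j _
        simp only [Fin.revPerm_apply, Fin.rev_rev]
        congr 2
        have := j.2
        rw [Fin.val_rev]
        omega
      · have hi' : (i : ℕ) ≠ P := fun h => hi (Fin.ext (by simpa using h))
        have hlt : (i : ℕ) + 1 < P + 1 := by have := i.2; omega
        rw [Finset.sum_eq_single (⟨(i : ℕ) + 1, hlt⟩ : Fin (P+1))]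
        · simp [hi', hi]
          congr 1
          ring
        · intro j _ hj
          have : (j : ℕ) ≠ (i : ℕ) + 1 := fun h => hj (Fin.ext h)
          simp [hi', this]
        · simp
    rw [step, ih, Finset.sum_range_succ, Matrix.mulVec_sum]
    congr 1
    · apply Finset.sum_congr rfl
      intro s hs
      have hs' := Finset.mem_range.1 hs
      rw [Matrix.mulVec_smul, Matrix.mulVec_mulVec, ← pow_succ']
      congr 3
      omega
    · rw [Nat.add_sub_cancel, Nat.sub_self, pow_zero, Matrix.one_mulVec]

theorem aux_norm (P : ℕ) (M : Matrix (Fin (P+1)) (Fin (P+1)) ℝ) (i : Fin (P+1)) :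
    |M.mulVec (Pi.single i 1) i| ≤ euclideanOpNorm M := by
  have h := (Matrix.toEuclideanCLM (𝕜 := ℝ) M).le_opNorm (EuclideanSpace.single i 1)
  have h2 := PiLp.norm_apply_le (Matrix.toEuclideanCLM (𝕜 := ℝ) M (EuclideanSpace.single i 1)) i
  have h3 : (Matrix.toEuclideanCLM (𝕜 := ℝ) M (EuclideanSpace.single i 1)) i
      = M.mulVec (Pi.single i 1) i := by
    simp [Matrix.ofLp_toEuclideanCLM]
  rw [h3] at h2
  simp only [EuclideanSpace.norm_single, norm_one, mul_one] at h
  exact h2.trans h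

theorem aux_imp (u : ℤ → ℝ) (k₀ : ℕ) (δ : ℝ) (hδ : 0 < δ)
    (hu : ∀ k : ℤ, k ≠ (k₀ : ℤ) → u k = 0) (hu0 : |u (k₀ : ℤ)| ≤ δ) (T j : ℕ) :
    ∑ n ∈ Finset.range T, |u ((n : ℤ) - (j : ℕ))| ≤ δ := by
  by_cases h : k₀ + j ∈ Finset.range T
  · rw [Finset.sum_eq_single_of_mem _ h]
    · simpa using hu0
    · intro n _ hn
      rw [hu _ (by omega), abs_zero]
  · rw [Finset.sum_eq_zero]
    · exact hδ.le
    · intro n hn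
      rw [hu, abs_zero]
      intro e
      apply h
      have : n = k₀ + j := by omega
      rwa [← this]

theorem aux_geom (g : ℕ → ℝ) (c l : ℝ) (hc : 0 < c) (hl : l ∈ Set.Ioo (0 : ℝ) 1)
    (h0 : g 0 ≤ 1) (hg : ∀ n, g n ≤ c * l ^ n) (N : ℕ) :
    ∑ n ∈ Finset.range N, g n ≤ 1 + c * l / (1 - l) := by
  have hl1 : 0 < 1 - l := by linarith [hl.2]
  have hpos : 0 ≤ c * l / (1 - l) := div_nonneg (mul_nonneg hc.le hl.1.le) hl1.le
  cases N with
  | zero => simp; linarith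
  | succ N =>
    rw [Finset.sum_range_succ']
    have : ∑ k ∈ Finset.range N, g (k+1) ≤ c * l / (1 - l) := by
      calc ∑ k ∈ Finset.range N, g (k+1) ≤ ∑ k ∈ Finset.range N, (c * l) * l ^ k := by
            apply Finset.sum_le_sum
            intro k _
            have := hg (k+1)
            rw [pow_succ] at this
            linarith
        _ = (c * l) * ∑ k ∈ Finset.range N, l ^ k := by rw [Finset.mul_sum]
        _ ≤ (c * l) * (1 - l)⁻¹ := by
            apply mul_le_mul_of_nonneg_left _ (mul_nonneg hc.le hl.1.le)
            rw [← tsum_geometric_of_lt_one hl.1.le hl.2]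
            exact (summable_geometric_of_lt_one hl.1.le hl.2).sum_le_tsum _
              (fun i _ => pow_nonneg hl.1.le i)
        _ = _ := by rw [div_eq_mul_inv]
    linarith

/-- Lemma 2: with `‖A^k‖ ≤ c₀ l^k`, a single input impulse of size at most `δ` at time `k₀`
(all other inputs and noises zero) yields `∑_{k=1}^{T} |y_k| ≤ (1 + √p c₀ l/(1−l)) (∑_j |b_j|) δ`. -/
theorem stmt2 (p : ℕ) (hp : 1 ≤ p) (a : Fin p → ℝ) (c₀ l : ℝ)
    (hc₀ : 0 < c₀) (hl : l ∈ Set.Ioo (0 : ℝ) 1)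
    (hA : ∀ k : ℕ, euclideanOpNorm ((companionMatrix a) ^ k) ≤ c₀ * l ^ k)
    (q : ℕ) (hq : 1 ≤ q) (b : Fin q → ℝ) (k₀ : ℕ) (δ : ℝ) (hδ : 0 < δ)
    (u : ℤ → ℝ) (hu : ∀ k : ℤ, k ≠ (k₀ : ℤ) → u k = 0) (hu0 : |u (k₀ : ℤ)| ≤ δ)
    (y : ℤ → ℝ) (hy0 : ∀ k : ℤ, k ≤ (k₀ : ℤ) → y k = 0)
    (hrec : ∀ k : ℤ, (k₀ : ℤ) ≤ k →
      y (k + 1) = (∑ j : Fin p, a j * y (k - (j : ℕ))) +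
        ∑ j : Fin q, b j * u (k - (j : ℕ))) :
    ∀ T : ℕ, 0 < T →
      ∑ k ∈ Finset.Icc 1 T, |y (k : ℤ)| ≤
        (1 + Real.sqrt p * c₀ * l / (1 - l)) * (∑ j : Fin q, |b j|) * δ := by
  intro T _
  obtain ⟨P, rfl⟩ : ∃ P, p = P + 1 := ⟨p - 1, by omega⟩
  set w : ℕ → ℝ := fun n => ∑ j : Fin q, b j * u ((n : ℤ) - (j : ℕ)) with hw
  set h : ℕ → ℝ := fun n =>
    ((companionMatrix a) ^ n).mulVec (Pi.single (Fin.last P) 1) (Fin.last P) with hh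
  have hrec' : ∀ n : ℕ, y ((n : ℤ) + 1) =
      (∑ j : Fin (P+1), a j * y ((n : ℤ) - (j : ℕ))) + w n := by
    intro n
    by_cases hn : (k₀ : ℤ) ≤ n
    · exact hrec n hn
    · rw [hy0 _ (by omega), Finset.sum_eq_zero, hw]
      · simp only
        rw [Finset.sum_eq_zero]
        · simp
        · intro j _
          rw [hu _ (by omega), mul_zero]
      · intro j _
        rw [hy0 _ (by omega), mul_zero]
  have hy : ∀ n : ℕ, y ((n + 1 : ℕ) : ℤ) = ∑ s ∈ Finset.range (n+1), w s * h (n - s) := by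
    intro n
    have := congrFun (aux_state P a y w (fun k hk => hy0 k (by omega)) hrec' (n+1)) (Fin.last P)
    simp only [Finset.sum_apply, Pi.smul_apply, smul_eq_mul, Fin.val_last,
      Nat.add_sub_cancel, sub_add_cancel] at this
    exact this
  have hH : ∀ N, ∑ n ∈ Finset.range N, |h n| ≤ 1 + c₀ * l / (1 - l) := by
    intro N
    apply aux_geom _ _ _ hc₀ hl
    · simp [hh]
    · intro n
      exact (aux_norm P _ _).trans (hA n)
  have hl1 : 0 < 1 - l := by linarith [hl.2]
  have hpos : 0 ≤ c₀ * l / (1 - l) := div_nonneg (mul_nonneg hc₀.le hl.1.le) hl1.le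
  have hW : ∑ n ∈ Finset.range T, |w n| ≤ (∑ j : Fin q, |b j|) * δ := by
    calc ∑ n ∈ Finset.range T, |w n|
        ≤ ∑ n ∈ Finset.range T, ∑ j : Fin q, |b j| * |u ((n : ℤ) - (j : ℕ))| := by
          apply Finset.sum_le_sum
          intro n _
          refine (Finset.abs_sum_le_sum_abs _ _).trans (le_of_eq ?_)
          simp only [abs_mul]
      _ = ∑ j : Fin q, |b j| * ∑ n ∈ Finset.range T, |u ((n : ℤ) - (j : ℕ))| := by
          rw [Finset.sum_comm]
          simp only [Finset.mul_sum]
      _ ≤ ∑ j : Fin q, |b j| * δ := by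
          apply Finset.sum_le_sum
          intro j _
          exact mul_le_mul_of_nonneg_left (aux_imp u k₀ δ hδ hu hu0 T j) (abs_nonneg _)
      _ = _ := by rw [Finset.sum_mul]
  have hsq : (1 : ℝ) ≤ Real.sqrt ((P + 1 : ℕ) : ℝ) := by
    rw [Real.one_le_sqrt]
    push_cast
    linarith [(Nat.cast_nonneg P : (0 : ℝ) ≤ P)]
  have hS : 0 ≤ (∑ j : Fin q, |b j|) * δ :=
    mul_nonneg (Finset.sum_nonneg fun _ _ => abs_nonneg _) hδ.le
  have hIcc : ∑ k ∈ Finset.Icc 1 T, |y (k : ℤ)| =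
      ∑ n ∈ Finset.range T, |y ((n + 1 : ℕ) : ℤ)| := by
    rw [Finset.range_eq_Ico, Finset.sum_Ico_add' (fun k : ℕ => |y (k : ℤ)|) 0 T 1]
    rfl
  calc ∑ k ∈ Finset.Icc 1 T, |y (k : ℤ)|
      ≤ ∑ n ∈ Finset.range T, ∑ s ∈ Finset.range (n+1), |w s| * |h (n - s)| := by
        rw [hIcc]
        apply Finset.sum_le_sum
        intro n _
        rw [hy]
        refine (Finset.abs_sum_le_sum_abs _ _).trans (le_of_eq ?_)
        simp only [abs_mul]
    _ = ∑ s ∈ Finset.range T, ∑ m ∈ Finset.range (T - s), |w s| * |h m| :=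
        Finset.sum_range_diag_flip T (fun s m => |w s| * |h m|)
    _ ≤ ∑ s ∈ Finset.range T, |w s| * (1 + c₀ * l / (1 - l)) := by
        apply Finset.sum_le_sum
        intro s _
        rw [← Finset.mul_sum]
        exact mul_le_mul_of_nonneg_left (hH _) (abs_nonneg _)
    _ = (∑ s ∈ Finset.range T, |w s|) * (1 + c₀ * l / (1 - l)) := by rw [Finset.sum_mul]
    _ ≤ ((∑ j : Fin q, |b j|) * δ) * (1 + c₀ * l / (1 - l)) :=
        mul_le_mul_of_nonneg_right hW (by linarith)
    _ ≤ ((∑ j : Fin q, |b j|) * δ) * (1 + Real.sqrt ((P + 1 : ℕ) : ℝ) * c₀ * l / (1 - l)) := by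
        apply mul_le_mul_of_nonneg_left _ hS
        have := mul_le_mul_of_nonneg_right hsq hpos
        have e : Real.sqrt ((P + 1 : ℕ) : ℝ) * c₀ * l / (1 - l) =
          Real.sqrt ((P + 1 : ℕ) : ℝ) * (c₀ * l / (1 - l)) := by ring
        rw [e]
        linarith
    _ = _ := by ring
end

section
/- (Theorem 1, conditional form.) Let c_0 > 0 and λ ∈ (0,1) satisfy ‖A^k‖ ≤ c_0 λ^k for all k ∈ ℕ, set C_1 = 1 + √p · c_0 λ/(1−λ), and let ε, δ, b_0 > 0 satisfy C_1 δ / b_0 ≤ ε. Let (y_k)_{k∈ℤ}, (y'_k)_{k∈ℤ} be real sequences with y_k = y'_k = 0 for k ≤ 0, let T_1 ≥ 1, and suppose ∑_{k=1}^{T_1} |y_k − y'_k| ≤ δ and, for every k ≥ T_1, y_{k+1} − ∑_{j=1}^p a_j y_{k+1−j} = y'_{k+1} − ∑_{j=1}^p a_j y'_{k+1−j}. Then for every T_2 ≥ T_1 and every Borel set D ⊆ ℝ^{T_2}: if η has law L(0,b_0)^{⊗T_2}, then P((y_1 + η_1, …, y_{T_2} + η_{T_2}) ∈ D) ≤ e^{ε}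 · P((y'_1 + η_1, …, y'_{T_2} + η_{T_2}) ∈ D). -/
open MeasureTheory

/-- The Laplace probability measure `L(0,b)` on `ℝ`. -/
noncomputable def laplaceMeasure (b : ℝ) : Measure ℝ :=
  volume.withDensity fun x => ENNReal.ofReal ((2 * b)⁻¹ * Real.exp (-|x| / b))

instance (b : ℝ) : SigmaFinite (laplaceMeasure b) :=
  SigmaFinite.withDensity_ofReal _

/-- The `T`-fold product `L(0,b)^{⊗T}` of Laplace measures on `ℝ^T`. -/
noncomputable def laplacePi (b : ℝ) (T : ℕ) : Measure (Fin T → ℝ) :=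
  Measure.pi fun _ => laplaceMeasure b

theorem aux_pi_le {n : ℕ} (μ ν : Fin n → Measure ℝ) [∀ i, SigmaFinite (μ i)]
    [∀ i, SigmaFinite (ν i)] (c : Fin n → NNReal) (h : ∀ i, μ i ≤ c i • ν i) :
    Measure.pi μ ≤ (∏ i, c i) • Measure.pi ν := by
  have h1 : Measure.pi (fun i => c i • ν i) = (∏ i, c i) • Measure.pi ν := by
    refine Measure.pi_eq fun s hs => ?_
    simp only [Measure.smul_apply, Measure.pi_pi, ENNReal.smul_def, smul_eq_mul]
    rw [Finset.prod_mul_distrib]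
    simp
  rw [← h1]
  have h2 : (Measure.pi μ).toOuterMeasure ≤
      OuterMeasure.pi (fun i => (c i • ν i).toOuterMeasure) := by
    rw [OuterMeasure.le_pi]
    intro s _
    change Measure.pi μ _ ≤ _
    rw [Measure.pi_pi]
    exact Finset.prod_le_prod' fun i _ => h i (s i)
  rw [Measure.le_iff]
  intro s hs
  conv_rhs => rw [Measure.pi]
  rw [toMeasure_apply _ _ hs]
  exact h2 s

theorem aux_one (b u v : ℝ) (hb : 0 < b) :
    (laplaceMeasure b).map (fun x => u + x) ≤
      (Real.toNNReal (Real.exp (|u - v| / b))) • (laplaceMeasure b).map (fun x => v + x) := by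
  rw [Measure.le_iff]
  intro s hs
  have hm : ∀ w : ℝ, Measurable (fun x : ℝ => w + x) := fun w => measurable_const_add w
  have key : ∀ w : ℝ, (laplaceMeasure b).map (fun x => w + x) s =
      ∫⁻ x, s.indicator (fun x => ENNReal.ofReal ((2 * b)⁻¹ * Real.exp (-|x - w| / b))) x := by
    intro w
    rw [Measure.map_apply (hm w) hs, laplaceMeasure, withDensity_apply _ (hm w hs),
      ← lintegral_indicator (hm w hs)]
    rw [← lintegral_add_left_eq_self (fun x => s.indicator
      (fun x => ENNReal.ofReal ((2 * b)⁻¹ * Real.exp (-|x - w| / b))) x) w]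
    refine lintegral_congr fun x => ?_
    by_cases hx : w + x ∈ s
    · rw [Set.indicator_of_mem hx, Set.indicator_of_mem (show x ∈ (fun x => w + x) ⁻¹' s from hx)]
      simp
    · rw [Set.indicator_of_notMem hx,
        Set.indicator_of_notMem (show x ∉ (fun x => w + x) ⁻¹' s from hx)]
  rw [Measure.smul_apply, key u, key v, ENNReal.smul_def, smul_eq_mul,
    ← lintegral_const_mul' _ _ ENNReal.coe_ne_top]
  refine lintegral_mono fun x => ?_
  by_cases hx : x ∈ s
  · simp only [Set.indicator_of_mem hx]
    change _ ≤ ENNReal.ofReal _ * _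
    rw [← ENNReal.ofReal_mul (Real.exp_pos _).le]
    apply ENNReal.ofReal_le_ofReal
    rw [mul_left_comm, ← Real.exp_add]
    gcongr
    rw [← add_div]
    gcongr
    have := abs_sub_le x u v
    linarith
  · simp [Set.indicator_of_notMem hx]

theorem aux_step {p : ℕ} (hp : 1 ≤ p) (a : Fin p → ℝ) (z : ℤ → ℝ) (k : ℤ)
    (h : z (k + 1) = ∑ j : Fin p, a j * z (k - (j : ℕ))) :
    (fun i : Fin p => z (k + 1 - (Fin.rev i : ℕ))) =
      (companionMatrix a).mulVec (fun i : Fin p => z (k - (Fin.rev i : ℕ))) := by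
  funext i
  simp only [Matrix.mulVec, dotProduct, companionMatrix, Matrix.of_apply]
  by_cases hi : (i : ℕ) = p - 1
  · simp only [hi, if_true]
    refine Eq.trans ?_ (Equiv.sum_comp Fin.revPerm (fun j : Fin p => a j * z (k - (j : ℕ)))).symm
    rw [← h]
    congr 1
    rw [Fin.val_rev]
    omega
  · simp only [hi, if_false]
    have hi2 : (i : ℕ) + 1 < p := by have := i.2; omega
    rw [Finset.sum_eq_single (⟨i + 1, hi2⟩ : Fin p)]
    · simp only [if_true, one_mul, Fin.val_rev]
      congr 1
      omega
    · intro j _ hj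
      rw [if_neg, zero_mul]
      intro h'
      exact hj (Fin.ext h')
    · simp

theorem aux_bound {p : ℕ} (hp : 1 ≤ p) (a : Fin p → ℝ) (c₀ l δ : ℝ)
    (hc₀ : 0 < c₀) (hl : l ∈ Set.Ioo (0 : ℝ) 1)
    (hA : ∀ k : ℕ, euclideanOpNorm ((companionMatrix a) ^ k) ≤ c₀ * l ^ k)
    (z : ℤ → ℝ) (h0 : ∀ k : ℤ, k ≤ 0 → z k = 0) (T : ℕ)
    (hadj : ∑ k ∈ Finset.range T, |z ((k : ℤ) + 1)| ≤ δ)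
    (hrec : ∀ k : ℤ, (T : ℤ) ≤ k → z (k + 1) = ∑ j : Fin p, a j * z (k - (j : ℕ))) (m : ℕ) :
    |z (T + m)| ≤ c₀ * l ^ m * δ := by
  let x : ℤ → Fin p → ℝ := fun k i => z (k - (Fin.rev i : ℕ))
  have hx : ∀ m : ℕ, x (T + m) = ((companionMatrix a) ^ m).mulVec (x T) := by
    intro m
    induction m with
    | zero => simp
    | succ m ih =>
      have := aux_step hp a z (T + m) (hrec _ (by omega))
      rw [pow_succ', ← Matrix.mulVec_mulVec, ← ih]
      push_cast
      rw [← add_assoc]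
      exact this
  have hn0 : ‖WithLp.toLp 2 (x T)‖ ≤ δ := by
    have e1 : ‖WithLp.toLp 2 (x T)‖ ≤ ∑ i, |x T i| := by
      rw [EuclideanSpace.norm_eq]
      apply Real.sqrt_le_iff.2
      refine ⟨Finset.sum_nonneg fun i _ => abs_nonneg _, ?_⟩
      exact Finset.sum_sq_le_sq_sum_of_nonneg (fun i _ => abs_nonneg _)
    refine e1.trans (le_trans ?_ hadj)
    have e2 : ∑ i, |x T i| = ∑ i ∈ Finset.range p, |z (T - (i : ℕ))| := by
      rw [← Fin.sum_univ_eq_sum_range (fun i : ℕ => |z (T - (i : ℕ))|)]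
      exact Equiv.sum_comp Fin.revPerm (fun j : Fin p => |z (T - (j : ℕ))|)
    rw [e2]
    calc _ ≤ ∑ i ∈ Finset.range (T + p), |z (T - (i : ℕ))| :=
          Finset.sum_le_sum_of_subset_of_nonneg (Finset.range_mono (by omega))
            (fun _ _ _ => abs_nonneg _)
      _ = ∑ i ∈ Finset.range T, |z (T - (i : ℕ))| := by
          rw [Finset.sum_range_add]
          simp only [add_eq_left]
          refine Finset.sum_eq_zero fun i _ => ?_
          rw [h0 _ (by push_cast; omega), abs_zero]
      _ ≤ _ := by
          rw [← Finset.sum_range_reflect]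
          refine (Finset.sum_congr rfl fun i hi => ?_).le
          rw [Finset.mem_range] at hi
          congr 2
          omega
  have h3 : |z (T + m)| ≤ ‖WithLp.toLp 2 (x (T + m))‖ := by
    have := PiLp.norm_apply_le (WithLp.toLp 2 (x (T + m))) (⟨p - 1, by omega⟩ : Fin p)
    refine le_trans (le_of_eq ?_) this
    simp only [x, Real.norm_eq_abs, Fin.val_rev]
    congr 2
    omega
  refine h3.trans ?_
  rw [hx m]
  have h4 := (Matrix.toEuclideanCLM (𝕜 := ℝ) ((companionMatrix a) ^ m)).le_opNorm
    (WithLp.toLp 2 (x T))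
  rw [Matrix.toEuclideanCLM_toLp] at h4
  refine h4.trans ?_
  have := hA m
  have hl0 := hl.1
  exact mul_le_mul this hn0 (norm_nonneg _) (by positivity)

theorem aux_sum {p : ℕ} (hp : 1 ≤ p) (a : Fin p → ℝ) (c₀ l δ : ℝ)
    (hc₀ : 0 < c₀) (hl : l ∈ Set.Ioo (0 : ℝ) 1) (hδ : 0 < δ)
    (hA : ∀ k : ℕ, euclideanOpNorm ((companionMatrix a) ^ k) ≤ c₀ * l ^ k)
    (z : ℤ → ℝ) (h0 : ∀ k : ℤ, k ≤ 0 → z k = 0) (T : ℕ)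
    (hadj : ∑ k ∈ Finset.range T, |z ((k : ℤ) + 1)| ≤ δ)
    (hrec : ∀ k : ℤ, (T : ℤ) ≤ k → z (k + 1) = ∑ j : Fin p, a j * z (k - (j : ℕ))) (n : ℕ) :
    ∑ k ∈ Finset.range (T + n), |z ((k : ℤ) + 1)| ≤
      (1 + Real.sqrt p * c₀ * l / (1 - l)) * δ := by
  have hl0 := hl.1
  have hl1 : 0 < 1 - l := sub_pos.2 hl.2
  rw [Finset.sum_range_add]
  have h1 : ∑ k ∈ Finset.range n, |z (((T + k : ℕ) : ℤ) + 1)| ≤ c₀ * l / (1 - l) * δ := by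
    calc _ ≤ ∑ k ∈ Finset.range n, c₀ * l * δ * l ^ k := by
          refine Finset.sum_le_sum fun k _ => ?_
          have := aux_bound hp a c₀ l δ hc₀ hl hA z h0 T hadj hrec (k + 1)
          push_cast at this ⊢
          rw [add_assoc]
          refine this.trans (le_of_eq (by ring))
      _ = c₀ * l * δ * ∑ k ∈ Finset.range n, l ^ k := by rw [Finset.mul_sum]
      _ ≤ c₀ * l * δ * (1 / (1 - l)) := by
          gcongr
          rw [le_div_iff₀ hl1, geom_sum_mul_neg]
          have : 0 ≤ l ^ n := by positivity
          linarith
      _ = _ := by ring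
  have h2 : c₀ * l / (1 - l) * δ ≤ Real.sqrt p * c₀ * l / (1 - l) * δ := by
    have : (1 : ℝ) ≤ Real.sqrt p := Real.one_le_sqrt.2 (by exact_mod_cast hp)
    gcongr
    exact le_mul_of_one_le_left (by positivity) (by linarith)
  linarith

/-- Theorem 1 (conditional form): differential privacy for Participant `P₀`.
If `C₁ δ / b₀ ≤ ε`, with `C₁ = 1 + √p c₀ l/(1−l)`, then for `δ`-adjacent output
trajectories `y, y'` satisfying the same recursion with identical forcing from time `T₁` on,
the Laplace-perturbed outputs satisfy the `ε`-differential-privacy inequality. -/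
theorem stmt4 (p : ℕ) (hp : 1 ≤ p) (a : Fin p → ℝ) (c₀ l : ℝ)
    (hc₀ : 0 < c₀) (hl : l ∈ Set.Ioo (0 : ℝ) 1)
    (hA : ∀ k : ℕ, euclideanOpNorm ((companionMatrix a) ^ k) ≤ c₀ * l ^ k)
    (C₁ : ℝ) (hC₁ : C₁ = 1 + Real.sqrt p * c₀ * l / (1 - l))
    (ε δ b₀ : ℝ) (hε : 0 < ε) (hδ : 0 < δ) (hb₀ : 0 < b₀)
    (hbudget : C₁ * δ / b₀ ≤ ε)
    (y y' : ℤ → ℝ) (hy0 : ∀ k : ℤ, k ≤ 0 → y k = 0) (hy'0 : ∀ k : ℤ, k ≤ 0 → y' k = 0)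
    (T₁ : ℕ) (hT₁ : 1 ≤ T₁)
    (hadj : ∑ k ∈ Finset.Icc 1 T₁, |y (k : ℤ) - y' (k : ℤ)| ≤ δ)
    (hrec : ∀ k : ℤ, (T₁ : ℤ) ≤ k →
      y (k + 1) - ∑ j : Fin p, a j * y (k - (j : ℕ)) =
        y' (k + 1) - ∑ j : Fin p, a j * y' (k - (j : ℕ))) :
    ∀ T₂ : ℕ, T₁ ≤ T₂ → ∀ D : Set (Fin T₂ → ℝ), MeasurableSet D →
      laplacePi b₀ T₂ {η | (fun k : Fin T₂ => y ((k : ℕ) + 1 : ℤ) + η k) ∈ D} ≤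
        ENNReal.ofReal (Real.exp ε) *
          laplacePi b₀ T₂ {η | (fun k : Fin T₂ => y' ((k : ℕ) + 1 : ℤ) + η k) ∈ D} := by
  intro T₂ hT D hD
  let z : ℤ → ℝ := fun k => y k - y' k
  have hsum : ∑ k : Fin T₂, |z ((k : ℕ) + 1 : ℤ)| ≤ C₁ * δ := by
    obtain ⟨n, rfl⟩ := Nat.exists_eq_add_of_le hT
    rw [Fin.sum_univ_eq_sum_range (fun k : ℕ => |z ((k : ℤ) + 1)|), hC₁]
    refine aux_sum hp a c₀ l δ hc₀ hl hδ hA z ?_ T₁ ?_ ?_ n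
    · intro k hk
      simp [z, hy0 k hk, hy'0 k hk]
    · refine le_trans (le_of_eq ?_) hadj
      rw [Finset.range_eq_Ico, ← Finset.Ico_add_one_right_eq_Icc]
      rw [Finset.sum_Ico_eq_sum_range, Finset.sum_Ico_eq_sum_range]
      simp [z, add_comm]
    · intro k hk
      have := hrec k hk
      simp only [z, mul_sub, Finset.sum_sub_distrib]
      linarith
  have hmap : ∀ w : ℤ → ℝ, laplacePi b₀ T₂ {η | (fun k : Fin T₂ => w ((k : ℕ) + 1 : ℤ) + η k) ∈ D}
      = Measure.pi (fun k : Fin T₂ =>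
          (laplaceMeasure b₀).map (fun x => w ((k : ℕ) + 1 : ℤ) + x)) D := by
    intro w
    haveI : ∀ k : Fin T₂, SigmaFinite
        ((laplaceMeasure b₀).map (fun x => w ((k : ℕ) + 1 : ℤ) + x)) := fun k =>
      (MeasurableEquiv.addLeft (w ((k : ℕ) + 1 : ℤ))).sigmaFinite_map
    rw [← Measure.pi_map_pi (fun k => (measurable_const_add _).aemeasurable),
      Measure.map_apply (by fun_prop) hD]
    rfl
  haveI hsf : ∀ (w : ℤ → ℝ) (k : Fin T₂), SigmaFinite
        ((laplaceMeasure b₀).map (fun x => w ((k : ℕ) + 1 : ℤ) + x)) := fun w k =>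
      (MeasurableEquiv.addLeft (w ((k : ℕ) + 1 : ℤ))).sigmaFinite_map
  rw [hmap y, hmap y']
  refine (aux_pi_le _ _ _ (fun k : Fin T₂ => aux_one b₀ (y ((k : ℕ) + 1 : ℤ))
    (y' ((k : ℕ) + 1 : ℤ)) hb₀) D).trans ?_
  rw [Measure.smul_apply, ENNReal.smul_def, smul_eq_mul]
  gcongr
  rw [ENNReal.ofReal, ENNReal.coe_le_coe, ← Real.toNNReal_prod_of_nonneg
    (fun _ _ => (Real.exp_pos _).le), ← Real.exp_sum]
  apply Real.toNNReal_le_toNNReal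
  rw [Real.exp_le_exp, ← Finset.sum_div]
  refine le_trans ?_ hbudget
  gcongr
end

section
/- (Theorem 2, conditional form.) Let c_0 > 0 and λ ∈ (0,1) satisfy ‖A^k‖ ≤ c_0 λ^k for all k ∈ ℕ. Let q ≥ 1 and b_{i,1}, …, b_{i,q} ∈ ℝ, set C_{i,2} = (1 + √p · c_0 λ/(1−λ)) ∑_{j=1}^{q} |b_{i,j}|, and let ε, δ, b_0, b_i > 0 satisfy (C_{i,2}/b_0 + 1/b_i) δ ≤ ε. Let T_1 ≥ 1 and let (u_k)_{k≥0}, (u'_k)_{k≥0} be real input sequences with u_k = u'_k for k ≥ T_1 and ∑_{k=0}^{T_1−1} |u_k − u'_k| ≤ δ. Let (y_k), (y'_k) be real sequences, zero for k ≤ 0, whose difference x_k = y'_k − y_k satisfies x_{k+1} = ∑_{j=1}^p a_j x_{k+1−j} + ∑_{j=1}^{q} b_{i,j}(u'_{k+1−j} − u_{k+1−j}) for all k ≥ 0. Then for every T_2 ≥ T_1 and every Borel set D ⊆ ℝ^{T_2} × ℝ^{T_2}: if η has law L(0,b_0)^{⊗T_2}, ξ has law L(0,b_i)^{⊗T_2},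 and η, ξ are independent, then P(((y_1+η_1,…,y_{T_2}+η_{T_2}), (u_0+ξ_1,…,u_{T_2−1}+ξ_{T_2})) ∈ D) ≤ e^{ε} · P(((y'_1+η_1,…,y'_{T_2}+η_{T_2}), (u'_0+ξ_1,…,u'_{T_2−1}+ξ_{T_2})) ∈ D). -/
open MeasureTheory

lemma laplace_translate_le (b : ℝ) (hb : 0 < b) (c c' : ℝ) (s : Set ℝ) (hs : MeasurableSet s) :
    laplaceMeasure b ((fun x => c + x) ⁻¹' s) ≤
      ENNReal.ofReal (Real.exp (|c' - c| / b)) * laplaceMeasure b ((fun x => c' + x) ⁻¹' s) := by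
  set f : ℝ → ENNReal := fun x => ENNReal.ofReal ((2 * b)⁻¹ * Real.exp (-|x| / b)) with hf
  have hfm : Measurable f := by fun_prop
  have key : ∀ d : ℝ, laplaceMeasure b ((fun x => d + x) ⁻¹' s) = ∫⁻ z in s, f (z - d) := by
    intro d
    have hm : MeasurableSet ((fun x => d + x) ⁻¹' s) := (measurable_const_add d) hs
    rw [laplaceMeasure, withDensity_apply _ hm, ← lintegral_indicator hm,
      ← lintegral_indicator hs,
      ← lintegral_add_left_eq_self (s.indicator fun z => f (z - d)) d]
    congr 1
    ext x
    simp only [Set.indicator, hf, add_sub_cancel_left]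
    rfl
  rw [key, key, ← lintegral_const_mul _ (by fun_prop)]
  refine lintegral_mono fun z => ?_
  simp only [hf]
  rw [← ENNReal.ofReal_mul (Real.exp_nonneg _)]
  apply ENNReal.ofReal_le_ofReal
  have h1 : Real.exp (-|z - c| / b) ≤ Real.exp (|c' - c| / b) * Real.exp (-|z - c'| / b) := by
    rw [← Real.exp_add, ← add_div]
    apply Real.exp_le_exp.2
    apply div_le_div_of_nonneg_right _ hb.le
    have : |z - c'| ≤ |z - c| + |c' - c| := by
      have := abs_sub (z - c) (c' - c)
      simpa using this
    linarith
  calc _ ≤ (2 * b)⁻¹ * (Real.exp (|c' - c| / b) * Real.exp (-|z - c'| / b)) := by gcongr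
    _ = _ := by ring

lemma pi_le_smul_pi {n : ℕ} (μ ν : Fin n → Measure ℝ) [∀ i, SigmaFinite (μ i)]
    [∀ i, SigmaFinite (ν i)] (r : Fin n → NNReal)
    (h : ∀ i, μ i ≤ (r i) • ν i) :
    Measure.pi μ ≤ (∏ i, r i) • Measure.pi ν := by
  have e : Measure.pi (fun i => (r i) • ν i) = (∏ i, r i) • Measure.pi ν := by
    apply Measure.pi_eq
    intro s hs
    simp only [Measure.smul_apply, Measure.pi_pi, ENNReal.smul_def, smul_eq_mul,
      Finset.prod_mul_distrib, ENNReal.ofNNReal_finsetProd]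
  rw [← e]
  have h2 : (Measure.pi μ).toOuterMeasure ≤
      OuterMeasure.pi fun i => ((r i) • ν i : Measure ℝ).toOuterMeasure := by
    rw [OuterMeasure.le_pi]
    intro s _
    simp only [Measure.coe_toOuterMeasure, Measure.pi_pi]
    exact Finset.prod_le_prod' fun i _ => h i (s i)
  refine Measure.le_iff.2 fun s hs => ?_
  rw [Measure.pi_def (fun i => (r i) • ν i), toMeasure_apply _ _ hs]
  exact h2 s

lemma laplacePi_map_le (b : ℝ) (hb : 0 < b) (T : ℕ) (c c' : Fin T → ℝ) :
    (laplacePi b T).map (fun x i => c i + x i) ≤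
      (Real.exp ((∑ i, |c' i - c i|) / b)).toNNReal •
        (laplacePi b T).map (fun x i => c' i + x i) := by
  have sf : ∀ d : ℝ, SigmaFinite ((laplaceMeasure b).map (fun x => d + x)) := fun d =>
    (MeasurableEquiv.addLeft d).sigmaFinite_map
  unfold laplacePi
  rw [Measure.pi_map_pi (f := fun i x => c i + x) (fun i => by fun_prop),
    Measure.pi_map_pi (f := fun i x => c' i + x) (fun i => by fun_prop)]
  have := pi_le_smul_pi (fun i => (laplaceMeasure b).map (fun x => c i + x))
    (fun i => (laplaceMeasure b).map (fun x => c' i + x))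
    (fun i => (Real.exp (|c' i - c i| / b)).toNNReal) (fun i => by
      refine Measure.le_iff.2 fun s hs => ?_
      rw [Measure.smul_apply, Measure.map_apply (by fun_prop) hs,
        Measure.map_apply (by fun_prop) hs]
      exact laplace_translate_le b hb _ _ s hs)
  convert this using 2
  rw [← Real.toNNReal_prod_of_nonneg (fun i _ => Real.exp_nonneg _), ← Real.exp_sum,
    Finset.sum_div]

lemma entry_le {p : ℕ} (M : Matrix (Fin p) (Fin p) ℝ) (i j : Fin p) :
    |M i j| ≤ euclideanOpNorm M := by
  have h := (Matrix.toEuclideanCLM (𝕜 := ℝ) M).le_opNorm (EuclideanSpace.single j 1)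
  have h2 := PiLp.norm_apply_le (Matrix.toEuclideanCLM (𝕜 := ℝ) M (EuclideanSpace.single j 1)) i
  have h3 : (Matrix.toEuclideanCLM (𝕜 := ℝ) M (EuclideanSpace.single j 1)) i = M i j := by
    rw [Matrix.ofLp_toEuclideanCLM]
    simp
  rw [h3] at h2
  simp only [EuclideanSpace.norm_single, norm_one, mul_one] at h
  exact h2.trans h

/-- variation of constants for the companion recursion -/
lemma companion_solution {p : ℕ} (hp : 1 ≤ p) (a : Fin p → ℝ) (x : ℤ → ℝ) (v : ℕ → ℝ)
    (h0 : ∀ k : ℤ, k ≤ 0 → x k = 0)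
    (hrec : ∀ k : ℕ, x ((k : ℤ) + 1) = (∑ j : Fin p, a j * x ((k : ℤ) - (j : ℕ))) + v k) (k : ℕ) :
    x ((k : ℤ) + 1) = ∑ m ∈ Finset.range (k + 1),
      v m * (companionMatrix a ^ (k - m)) ⟨p - 1, by omega⟩ ⟨p - 1, by omega⟩ := by
  set A := companionMatrix a
  set e : Fin p := ⟨p - 1, by omega⟩ with he
  let X : ℕ → Fin p → ℝ := fun k i => x ((k : ℤ) - (p - 1 : ℕ) + (i : ℕ))
  have hX0 : X 0 = 0 := by
    funext i
    apply h0
    have := i.2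
    push_cast
    omega
  have hstep : ∀ k, X (k + 1) = A.mulVec (X k) + Pi.single e (v k) := by
    intro k
    funext i
    have hi := i.2
    simp only [Pi.add_apply, Matrix.mulVec, dotProduct, X, A, companionMatrix, Matrix.of_apply]
    by_cases hie : (i : ℕ) = p - 1
    · have : i = e := Fin.ext hie
      subst this
      simp only [hie, if_true, Pi.single_eq_same]
      rw [show (((k + 1 : ℕ) : ℤ) - (p - 1 : ℕ) + (p - 1 : ℕ)) = (k : ℤ) + 1 by push_cast; ring,
        hrec k]
      congr 1
      rw [← Equiv.sum_comp Fin.revPerm]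
      apply Finset.sum_congr rfl
      intro j _
      simp only [Fin.revPerm_apply]
      congr 2
      have := j.2
      rw [Fin.val_rev]
      omega
    · have hne : i ≠ e := fun h => hie (by rw [h])
      simp only [hie, if_false, Pi.single_eq_of_ne hne, add_zero]
      rw [Finset.sum_eq_single (⟨(i : ℕ) + 1, by omega⟩ : Fin p)]
      · simp only [if_true, one_mul]
        congr 1
        push_cast
        ring
      · intro j _ hj
        rw [if_neg (fun h => hj (Fin.ext h)), zero_mul]
      · simp
  have hsol : ∀ k, X k = ∑ m ∈ Finset.range k, (A ^ (k - 1 - m)).mulVec (Pi.single e (v m)) := by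
    intro k
    induction k with
    | zero => simpa using hX0
    | succ k ih =>
      rw [hstep, ih, Finset.sum_range_succ, Matrix.mulVec_sum]
      congr 1
      · apply Finset.sum_congr rfl
        intro m hm
        have := Finset.mem_range.1 hm
        rw [Matrix.mulVec_mulVec, ← pow_succ']
        congr 2
        omega
      · rw [show k + 1 - 1 - k = 0 by omega, pow_zero, Matrix.one_mulVec]
  have hf := congrFun (hsol (k + 1)) e
  have hx : X (k + 1) e = x ((k : ℤ) + 1) := by
    simp only [X, he]
    congr 1
    push_cast
    ring
  rw [← hx, hf, Finset.sum_apply]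
  apply Finset.sum_congr rfl
  intro m _
  simp [Matrix.mulVec_single, mul_comm]

lemma sum_conv_le (T : ℕ) (f g : ℕ → ℝ) (hf : ∀ n, 0 ≤ f n) (hg : ∀ n, 0 ≤ g n) :
    ∑ k ∈ Finset.range T, ∑ m ∈ Finset.range (k + 1), f m * g (k - m) ≤
      (∑ m ∈ Finset.range T, f m) * ∑ m ∈ Finset.range T, g m := by
  rw [Finset.sum_range_diag_flip T (fun m n => f m * g n), Finset.sum_mul]
  apply Finset.sum_le_sum
  intro m _
  rw [← Finset.mul_sum]
  apply mul_le_mul_of_nonneg_left _ (hf m)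
  apply Finset.sum_le_sum_of_subset_of_nonneg
  · intro i; simp only [Finset.mem_range]; omega
  · intro i _ _; exact hg i

lemma sum_shift_le (T j : ℕ) (w : ℕ → ℝ) (hw : ∀ n, 0 ≤ w n) :
    ∑ k ∈ Finset.range T, (if j ≤ k then w (k - j) else 0) ≤ ∑ k ∈ Finset.range T, w k := by
  induction T with
  | zero => simp
  | succ T _ =>
  rw [← Finset.sum_filter]
  refine le_trans (le_of_eq ?_) (Finset.sum_le_sum_of_subset_of_nonneg
    (s := ((Finset.range (T + 1)).filter (fun k => j ≤ k)).image (fun k => k - j)) ?_ ?_)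
  · rw [Finset.sum_image]
    intro x hx y hy h
    simp at hx hy h
    omega
  · intro i
    simp only [Finset.mem_image, Finset.mem_filter, Finset.mem_range]
    rintro ⟨k, hk, rfl⟩
    omega
  · intro i _ _; exact hw i

lemma impulse_sum_le {p : ℕ} (hp : 1 ≤ p) (a : Fin p → ℝ) (c₀ l : ℝ)
    (hc₀ : 0 < c₀) (hl : l ∈ Set.Ioo (0 : ℝ) 1)
    (hA : ∀ k : ℕ, euclideanOpNorm ((companionMatrix a) ^ k) ≤ c₀ * l ^ k) (e : Fin p) (T : ℕ) :
    ∑ k ∈ Finset.range T, |(companionMatrix a ^ k) e e| ≤ 1 + Real.sqrt p * c₀ * l / (1 - l) := by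
  obtain ⟨hl0, hl1⟩ := hl
  have h1l : 0 < 1 - l := by linarith
  have hsq : 1 ≤ Real.sqrt p := Real.one_le_sqrt.2 (by exact_mod_cast hp)
  have h1 : ∑ k ∈ Finset.range T, |(companionMatrix a ^ k) e e| ≤
      ∑ k ∈ Finset.range (T + 1), |(companionMatrix a ^ k) e e| := by
    rw [Finset.sum_range_succ]
    linarith [abs_nonneg ((companionMatrix a ^ T) e e)]
  refine h1.trans ?_
  rw [Finset.sum_range_succ']
  have h2 : ∑ k ∈ Finset.range T, |(companionMatrix a ^ (k + 1)) e e| ≤ c₀ * l / (1 - l) := by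
    calc _ ≤ ∑ k ∈ Finset.range T, c₀ * l * l ^ k := by
          apply Finset.sum_le_sum
          intro k _
          refine (entry_le _ _ _).trans ((hA _).trans (le_of_eq ?_))
          ring
      _ = c₀ * l * ∑ k ∈ Finset.range T, l ^ k := by rw [Finset.mul_sum]
      _ ≤ c₀ * l * (1 - l)⁻¹ := by
          gcongr
          rw [← tsum_geometric_of_lt_one hl0.le hl1]
          exact (summable_geometric_of_lt_one hl0.le hl1).sum_le_tsum _ (fun _ _ => by positivity)
      _ = _ := by ring
  have h3 : c₀ * l / (1 - l) ≤ Real.sqrt p * c₀ * l / (1 - l) := by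
    apply div_le_div_of_nonneg_right _ h1l.le
    have : 0 < c₀ * l := by positivity
    nlinarith
  simp only [pow_zero, Matrix.one_apply_eq, abs_one]
  linarith

/-- Theorem 2 (conditional form): differential privacy for Participant `Pᵢ`.
With `C_{i,2} = (1 + √p c₀ l/(1−l)) ∑_j |b_{i,j}|` and `(C_{i,2}/b₀ + 1/bᵢ) δ ≤ ε`,
for `δ`-adjacent input trajectories `u, u'` (equal from time `T₁` on) whose corresponding
output difference satisfies the ARX recursion, the jointly Laplace-perturbed data
(independent output and input noises, modeled by the product measure) satisfy the
`ε`-differential-privacy inequality. -/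
theorem stmt5 (p : ℕ) (hp : 1 ≤ p) (a : Fin p → ℝ) (c₀ l : ℝ)
    (hc₀ : 0 < c₀) (hl : l ∈ Set.Ioo (0 : ℝ) 1)
    (hA : ∀ k : ℕ, euclideanOpNorm ((companionMatrix a) ^ k) ≤ c₀ * l ^ k)
    (q : ℕ) (hq : 1 ≤ q) (bc : Fin q → ℝ)
    (Ci2 : ℝ) (hCi2 : Ci2 = (1 + Real.sqrt p * c₀ * l / (1 - l)) * ∑ j : Fin q, |bc j|)
    (ε δ b₀ bᵢ : ℝ) (hε : 0 < ε) (hδ : 0 < δ) (hb₀ : 0 < b₀) (hbᵢ : 0 < bᵢ)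
    (hbudget : (Ci2 / b₀ + 1 / bᵢ) * δ ≤ ε)
    (T₁ : ℕ) (hT₁ : 1 ≤ T₁)
    (u u' : ℕ → ℝ) (hueq : ∀ k : ℕ, T₁ ≤ k → u k = u' k)
    (hadj : ∑ k ∈ Finset.range T₁, |u k - u' k| ≤ δ)
    (y y' : ℤ → ℝ) (hy0 : ∀ k : ℤ, k ≤ 0 → y k = 0) (hy'0 : ∀ k : ℤ, k ≤ 0 → y' k = 0)
    (hrec : ∀ k : ℕ,
      y' ((k : ℤ) + 1) - y ((k : ℤ) + 1) =
        (∑ j : Fin p, a j * (y' ((k : ℤ) - (j : ℕ)) - y ((k : ℤ) - (j : ℕ)))) +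
          ∑ j : Fin q, bc j * ((if (j : ℕ) ≤ k then u' (k - (j : ℕ)) - u (k - (j : ℕ)) else 0))) :
    ∀ T₂ : ℕ, T₁ ≤ T₂ → ∀ D : Set ((Fin T₂ → ℝ) × (Fin T₂ → ℝ)), MeasurableSet D →
      ((laplacePi b₀ T₂).prod (laplacePi bᵢ T₂))
          {ηξ | ((fun k : Fin T₂ => y ((k : ℕ) + 1 : ℤ) + ηξ.1 k),
                 (fun k : Fin T₂ => u (k : ℕ) + ηξ.2 k)) ∈ D} ≤
        ENNReal.ofReal (Real.exp ε) *
          ((laplacePi b₀ T₂).prod (laplacePi bᵢ T₂))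
            {ηξ | ((fun k : Fin T₂ => y' ((k : ℕ) + 1 : ℤ) + ηξ.1 k),
                   (fun k : Fin T₂ => u' (k : ℕ) + ηξ.2 k)) ∈ D} := by
  intro T₂ hT D hD
  set w : ℕ → ℝ := fun k => |u' k - u k| with hw
  have hw0 : ∀ n, 0 ≤ w n := fun n => abs_nonneg _
  have hwsum : ∑ k ∈ Finset.range T₂, w k ≤ δ := by
    refine le_trans (le_of_eq ?_) hadj
    rw [← Finset.sum_subset (Finset.range_mono hT)]
    · exact Finset.sum_congr rfl fun k _ => abs_sub_comm _ _
    · intro k _ hk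
      simp only [hw]
      rw [hueq k (by simpa using hk)]
      simp
  set v : ℕ → ℝ := fun k => ∑ j : Fin q, bc j *
    ((if (j : ℕ) ≤ k then u' (k - (j : ℕ)) - u (k - (j : ℕ)) else 0)) with hv
  have hvsum : ∑ k ∈ Finset.range T₂, |v k| ≤ (∑ j : Fin q, |bc j|) * δ := by
    calc ∑ k ∈ Finset.range T₂, |v k|
        ≤ ∑ k ∈ Finset.range T₂, ∑ j : Fin q,
            |bc j| * (if (j : ℕ) ≤ k then w (k - (j : ℕ)) else 0) := by
          apply Finset.sum_le_sum
          intro k _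
          refine (Finset.abs_sum_le_sum_abs _ _).trans (le_of_eq ?_)
          apply Finset.sum_congr rfl
          intro j _
          rw [abs_mul]
          split_ifs <;> simp [hw]
      _ = ∑ j : Fin q, |bc j| * ∑ k ∈ Finset.range T₂,
            (if (j : ℕ) ≤ k then w (k - (j : ℕ)) else 0) := by
          rw [Finset.sum_comm]
          simp_rw [Finset.mul_sum]
      _ ≤ ∑ j : Fin q, |bc j| * δ := by
          apply Finset.sum_le_sum
          intro j _
          exact mul_le_mul_of_nonneg_left ((sum_shift_le _ _ w hw0).trans hwsum) (abs_nonneg _)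
      _ = _ := by rw [Finset.sum_mul]
  have hsol := companion_solution hp a (fun k => y' k - y k) v
    (fun k hk => by simp [hy0 k hk, hy'0 k hk]) hrec
  have hxsum : ∑ k ∈ Finset.range T₂, |y' ((k : ℤ) + 1) - y ((k : ℤ) + 1)| ≤ Ci2 * δ := by
    calc _ ≤ ∑ k ∈ Finset.range T₂, ∑ m ∈ Finset.range (k + 1), |v m| *
            |(companionMatrix a ^ (k - m)) ⟨p - 1, by omega⟩ ⟨p - 1, by omega⟩| := by
          apply Finset.sum_le_sum
          intro k _
          rw [hsol k]
          refine (Finset.abs_sum_le_sum_abs _ _).trans (le_of_eq ?_)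
          simp_rw [abs_mul]
      _ ≤ (∑ m ∈ Finset.range T₂, |v m|) * ∑ m ∈ Finset.range T₂,
            |(companionMatrix a ^ m) ⟨p - 1, by omega⟩ ⟨p - 1, by omega⟩| :=
          sum_conv_le T₂ (fun m => |v m|) (fun m => |(companionMatrix a ^ m)
            ⟨p - 1, by omega⟩ ⟨p - 1, by omega⟩|) (fun _ => abs_nonneg _) (fun _ => abs_nonneg _)
      _ ≤ ((∑ j : Fin q, |bc j|) * δ) * (1 + Real.sqrt p * c₀ * l / (1 - l)) := by
          apply mul_le_mul hvsum (impulse_sum_le hp a c₀ l hc₀ hl hA _ _)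
          · exact Finset.sum_nonneg fun _ _ => abs_nonneg _
          · exact mul_nonneg (Finset.sum_nonneg fun _ _ => abs_nonneg _) hδ.le
      _ = Ci2 * δ := by rw [hCi2]; ring
  set Y : Fin T₂ → ℝ := fun k => y ((k : ℕ) + 1 : ℤ)
  set Y' : Fin T₂ → ℝ := fun k => y' ((k : ℕ) + 1 : ℤ)
  set U : Fin T₂ → ℝ := fun k => u (k : ℕ)
  set U' : Fin T₂ → ℝ := fun k => u' (k : ℕ)
  have hY : ∑ i, |Y' i - Y i| ≤ Ci2 * δ := by
    rw [← Fin.sum_univ_eq_sum_range (fun k : ℕ => |y' ((k : ℤ) + 1) - y ((k : ℤ) + 1)|)] at hxsum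
    exact hxsum
  have hU : ∑ i, |U' i - U i| ≤ δ := by
    rw [← Fin.sum_univ_eq_sum_range] at hwsum
    exact hwsum
  have sfp : ∀ b : ℝ, SigmaFinite (laplacePi b T₂) := fun b => by
    unfold laplacePi; infer_instance
  have mm : ∀ c : Fin T₂ → ℝ, Measurable (fun (x : Fin T₂ → ℝ) i => c i + x i) := fun c => by
    fun_prop
  have key := Measure.prod_mono (laplacePi_map_le b₀ hb₀ T₂ Y Y') (laplacePi_map_le bᵢ hbᵢ T₂ U U')
  rw [Measure.prod_smul_left, Measure.prod_smul_right,
    Measure.map_prod_map _ _ (mm _) (mm _), Measure.map_prod_map _ _ (mm _) (mm _)] at key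
  have k2 := key D
  rw [Measure.smul_apply, Measure.smul_apply, Measure.map_apply ((mm _).prodMap (mm _)) hD,
    Measure.map_apply ((mm _).prodMap (mm _)) hD] at k2
  refine k2.trans ?_
  rw [smul_smul, ENNReal.smul_def, smul_eq_mul]
  refine mul_le_mul' ?_ le_rfl
  rw [ENNReal.ofReal, ENNReal.coe_le_coe, ← Real.toNNReal_mul (Real.exp_nonneg _), ← Real.exp_add]
  apply Real.toNNReal_le_toNNReal
  apply Real.exp_le_exp.2
  calc _ ≤ Ci2 * δ / b₀ + δ / bᵢ := by gcongr
    _ = (Ci2 / b₀ + 1 / bᵢ) * δ := by ring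
    _ ≤ ε := hbudget
end

section
/- (Lemma 3.) In the recursive least-squares matrix recursion, for every k ∈ ℕ, ∑_{t=0}^{k} ā_t · φ_t^T P_t φ_t ≤ ln det(P_{k+1}^{−1}) − ln det(P_0^{−1}). -/
open Matrix

theorem rls_step {n : ℕ} (P Q : Matrix (Fin n) (Fin n) ℝ) (f : Fin n → ℝ) (a : ℝ)
    (hP : P.PosDef) (ha : a = (1 + f ⬝ᵥ P.mulVec f)⁻¹)
    (hQ : Q = P - a • (P * Matrix.vecMulVec f f * P)) :
    Q.PosDef ∧ a * (f ⬝ᵥ P.mulVec f) ≤ Real.log (Q⁻¹).det - Real.log (P⁻¹).det := by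
  have hs : 0 ≤ f ⬝ᵥ P.mulVec f := by
    simpa using hP.posSemidef.dotProduct_mulVec_nonneg f
  set s := f ⬝ᵥ P.mulVec f with hsdef
  have hpos : 0 < 1 + s := by linarith
  have has : a * (1 + s) = 1 := by rw [ha]; exact inv_mul_cancel₀ hpos.ne'
  have hdetP : IsUnit P.det := hP.det_pos.ne'.isUnit
  have hVPV : Matrix.vecMulVec f f * P * Matrix.vecMulVec f f = s • Matrix.vecMulVec f f := by
    rw [Matrix.mul_assoc, Matrix.mul_vecMulVec, Matrix.vecMulVec_mul_vecMulVec,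
      ← hsdef]
    try (ext i j; simp [Matrix.vecMulVec_apply]; try ring)
  have hmul : Q * (P⁻¹ + Matrix.vecMulVec f f) = 1 := by
    have e1 : P * Matrix.vecMulVec f f * P * P⁻¹ = P * Matrix.vecMulVec f f := by
      rw [Matrix.mul_assoc, Matrix.mul_nonsing_inv _ hdetP, Matrix.mul_one]
    have e2 : P * Matrix.vecMulVec f f * P * Matrix.vecMulVec f f
        = s • (P * Matrix.vecMulVec f f) := by
      rw [Matrix.mul_assoc P, Matrix.mul_assoc P, hVPV, Matrix.mul_smul]
    rw [hQ, Matrix.mul_add, Matrix.sub_mul, Matrix.sub_mul, Matrix.mul_nonsing_inv _ hdetP,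
      Matrix.smul_mul, Matrix.smul_mul, e1, e2]
    have : a * s = 1 - a := by linarith
    rw [smul_smul, this]
    module
  have hR : (P⁻¹ + Matrix.vecMulVec f f).PosDef := by
    refine hP.inv.add_posSemidef ?_
    simpa using Matrix.posSemidef_vecMulVec_self_star f
  have hQinv : Q⁻¹ = P⁻¹ + Matrix.vecMulVec f f := Matrix.inv_eq_right_inv hmul
  have hQP : Q.PosDef := by
    rw [← Matrix.inv_eq_left_inv hmul]; exact hR.inv
  refine ⟨hQP, ?_⟩
  have hdet : (Q⁻¹).det = (P⁻¹).det * (1 + s) := by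
    have : P⁻¹ + Matrix.vecMulVec f f
        = P⁻¹ * (1 + Matrix.replicateCol Unit (P.mulVec f) * Matrix.replicateRow Unit f) := by
      rw [← Matrix.vecMulVec_eq, Matrix.mul_add, Matrix.mul_one, Matrix.mul_vecMulVec,
        Matrix.mulVec_mulVec, Matrix.nonsing_inv_mul _ hdetP, Matrix.one_mulVec]
    rw [hQinv, this, Matrix.det_mul, Matrix.det_one_add_replicateCol_mul_replicateRow]
  rw [hdet, Real.log_mul hP.inv.det_pos.ne' hpos.ne']
  have := Real.one_sub_inv_le_log_of_pos hpos
  rw [← ha] at this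
  linarith

/-- Lemma 3: in the recursive least-squares matrix recursion, for every `k`,
`∑_{t=0}^{k} ā_t φ_tᵀ P_t φ_t ≤ ln det(P_{k+1}⁻¹) − ln det(P_0⁻¹)`. -/
theorem stmt8 (n : ℕ) (hn : 1 ≤ n)
    (P : ℕ → Matrix (Fin n) (Fin n) ℝ) (φ : ℕ → Fin n → ℝ) (abar : ℕ → ℝ)
    (hP0 : (P 0).PosDef)
    (habar : ∀ k : ℕ, abar k = (1 + φ k ⬝ᵥ (P k).mulVec (φ k))⁻¹)
    (hPrec : ∀ k : ℕ,
      P (k + 1) = P k - abar k • (P k * Matrix.vecMulVec (φ k) (φ k) * P k)) :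
    ∀ k : ℕ,
      ∑ t ∈ Finset.range (k + 1), abar t * (φ t ⬝ᵥ (P t).mulVec (φ t)) ≤
        Real.log ((P (k + 1))⁻¹).det - Real.log ((P 0)⁻¹).det := by
  have hpd : ∀ k, (P k).PosDef := by
    intro k
    induction k with
    | zero => exact hP0
    | succ k ih => exact (rls_step _ _ _ _ ih (habar k) (hPrec k)).1
  intro k
  rw [← Finset.sum_range_sub (fun t => Real.log ((P t)⁻¹).det)]
  exact Finset.sum_le_sum fun t _ => (rls_step _ _ _ _ (hpd t) (habar t) (hPrec t)).2
end

section
/- For every real number β there exist a constant γ > 0 and a strictly increasing sequence (k_i)_{i≥1} of positive integers such that cos(k_i β) ≥ γ for all i ≥ 1. -/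
/-- For every real `β` there are `γ > 0` and a strictly increasing sequence of positive
integers `k₁ < k₂ < ⋯` with `cos(kᵢ β) ≥ γ` for all `i`. -/
theorem stmt11 (β : ℝ) :
    ∃ γ : ℝ, 0 < γ ∧ ∃ k : ℕ → ℕ, StrictMono k ∧ (∀ i : ℕ, 0 < k i) ∧
      ∀ i : ℕ, γ ≤ Real.cos ((k i : ℝ) * β) := by
  have key : ∀ N : ℕ, ∃ n : ℕ, N < n ∧ (0 < n ∧ 1 / 2 ≤ Real.cos ((n : ℝ) * β)) := by
    intro N
    obtain ⟨k, hk, -, h⟩ := Real.exists_nat_abs_mul_sub_round_le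
      (((N + 1 : ℕ) : ℝ) * β / (2 * Real.pi)) (n := 5) (by norm_num)
    have hpi := Real.pi_pos
    have hle : N + 1 ≤ k * (N + 1) := Nat.le_mul_of_pos_left _ hk
    refine ⟨k * (N + 1), by omega, by omega, ?_⟩
    generalize round ((k : ℝ) * (((N + 1 : ℕ) : ℝ) * β / (2 * Real.pi))) = j at h
    rw [← Real.cos_sub_int_mul_two_pi _ j, ← Real.cos_abs, ← Real.cos_pi_div_three]
    have e : ((k * (N + 1) : ℕ) : ℝ) * β - j * (2 * Real.pi)
        = (2 * Real.pi) * ((k : ℝ) * (((N + 1 : ℕ) : ℝ) * β / (2 * Real.pi)) - j) := by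
      push_cast
      field_simp
    have hb : |((k * (N + 1) : ℕ) : ℝ) * β - j * (2 * Real.pi)| ≤ Real.pi / 3 := by
      rw [e, abs_mul, abs_of_pos (by positivity : (0 : ℝ) < 2 * Real.pi)]
      have := mul_le_mul_of_nonneg_left h (by positivity : (0 : ℝ) ≤ 2 * Real.pi)
      refine this.trans (le_of_eq ?_)
      push_cast
      ring
    exact Real.cos_le_cos_of_nonneg_of_le_pi (abs_nonneg _) (by linarith) hb
  obtain ⟨k, hk, h⟩ := Nat.exists_strictMono_subsequence key
  exact ⟨1 / 2, by norm_num, k, hk, fun i => (h i).1, fun i => (h i).2⟩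
end

section
/- (Lemma 5.) Let ε, δ > 0, let m ≥ 1, p ≥ 1 and q_1, …, q_m ≥ 1 be integers, let C_1 > 0, C_{1,2}, …, C_{m,2} ≥ 0 and γ > 0 be real constants. Define the feasible set S = { (b_0, b_1, …, b_m) ∈ ℝ^{m+1} : b_i > 0 for all i, C_1 δ / b_0 ≤ ε, and (C_{i,2}/b_0 + 1/b_i) δ ≤ ε for i = 1, …, m } and the objective f(b_0, …, b_m) = (p b_0² + ∑_{i=1}^m q_i b_i²) / (γ + 2 min_{0 ≤ i ≤ m} b_i²). Then f attains its infimum over S: there exists b* ∈ S with f(b*) = inf_{b ∈ S} f(b); moreover, there is R > 0 such that some minimizer b* satisfies b*_i ≤ R for every i. -/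
/-- Lemma 5: the objective
`f(b) = (p b₀² + ∑ᵢ qᵢ bᵢ²)/(γ + 2 min_{0≤i≤m} bᵢ²)` attains its infimum over the feasible
set `S = {b : bᵢ > 0, C₁δ/b₀ ≤ ε, (C_{i,2}/b₀ + 1/bᵢ)δ ≤ ε}`, and some minimizer lies in a
bounded set. Coordinates are indexed by `Fin (m+1)`, with index `0` playing the role of `b₀`
and `i.succ` the role of `bᵢ`. -/
theorem stmt14 (ε δ : ℝ) (hε : 0 < ε) (hδ : 0 < δ)
    (m p : ℕ) (hm : 1 ≤ m) (hp : 1 ≤ p)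
    (q : Fin m → ℕ) (hq : ∀ i, 1 ≤ q i)
    (C₁ : ℝ) (hC₁ : 0 < C₁) (C₂ : Fin m → ℝ) (hC₂ : ∀ i, 0 ≤ C₂ i)
    (γ : ℝ) (hγ : 0 < γ)
    (S : Set (Fin (m + 1) → ℝ))
    (hS : S = {b | (∀ i, 0 < b i) ∧ C₁ * δ / b 0 ≤ ε ∧
      ∀ i : Fin m, (C₂ i / b 0 + 1 / b i.succ) * δ ≤ ε})
    (f : (Fin (m + 1) → ℝ) → ℝ)
    (hf : ∀ b, f b = ((p : ℝ) * (b 0) ^ 2 + ∑ i : Fin m, (q i : ℝ) * (b i.succ) ^ 2) /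
      (γ + 2 * Finset.univ.inf' Finset.univ_nonempty (fun i : Fin (m + 1) => (b i) ^ 2))) :
    ∃ bstar ∈ S, (∀ b ∈ S, f bstar ≤ f b) ∧
      ∃ R : ℝ, 0 < R ∧ ∀ i, bstar i ≤ R := by
  have key : ∀ b : Fin (m + 1) → ℝ, (∀ i, 0 < b i) → (b ∈ S ↔ (C₁ * δ ≤ ε * b 0 ∧
      ∀ i : Fin m, C₂ i * δ * b i.succ + δ * b 0 ≤ ε * (b 0 * b i.succ))) := by
    intro b hb
    rw [hS]
    simp only [Set.mem_ofPred_eq]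
    have h0 := hb 0
    have e1 : C₁ * δ / b 0 ≤ ε ↔ C₁ * δ ≤ ε * b 0 := div_le_iff₀ h0
    have e2 : ∀ i : Fin m, (C₂ i / b 0 + 1 / b i.succ) * δ ≤ ε ↔
        C₂ i * δ * b i.succ + δ * b 0 ≤ ε * (b 0 * b i.succ) := by
      intro i
      have hi := hb i.succ
      rw [← div_le_iff₀ (mul_pos h0 hi)]
      have : (C₂ i / b 0 + 1 / b i.succ) * δ =
          (C₂ i * δ * b i.succ + δ * b 0) / (b 0 * b i.succ) := by
        field_simp
      rw [this]
    simp only [e1, e2]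
    exact ⟨fun h => h.2, fun h => ⟨hb, h⟩⟩
  obtain ⟨c, hc, hcC, hc1⟩ : ∃ c : ℝ, 0 < c ∧ ε * c ≤ C₁ * δ ∧ ε * c ≤ δ := by
    refine ⟨min C₁ 1 * δ / ε, by positivity, ?_, ?_⟩
    · rw [mul_div_cancel₀ _ hε.ne']
      exact mul_le_mul_of_nonneg_right (min_le_left _ _) hδ.le
    · rw [mul_div_cancel₀ _ hε.ne']
      nlinarith [min_le_right C₁ 1]
  have low : ∀ b ∈ S, ∀ i, c ≤ b i := by
    intro b hb
    have hpos : ∀ i, 0 < b i := by rw [hS] at hb; exact hb.1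
    obtain ⟨h1, h2⟩ := (key b hpos).1 hb
    intro i
    refine Fin.cases ?_ (fun i => ?_) i
    · exact le_of_mul_le_mul_left (hcC.trans h1) hε
    · have h3 := h2 i
      have h4 : 0 ≤ C₂ i * δ * b i.succ :=
        mul_nonneg (mul_nonneg (hC₂ i) hδ.le) (hpos _).le
      have h5 : b 0 * δ ≤ b 0 * (ε * b i.succ) := by nlinarith
      have h6 := le_of_mul_le_mul_left h5 (hpos 0)
      exact le_of_mul_le_mul_left (hc1.trans h6) hε
  have hsum : 0 ≤ ∑ i, C₂ i := Finset.sum_nonneg fun i _ => hC₂ i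
  obtain ⟨T, hT, hTC⟩ : ∃ T : ℝ, 0 < T ∧ ε * T = (C₁ + ∑ i, C₂ i + 1) * δ :=
    ⟨(C₁ + ∑ i, C₂ i + 1) * δ / ε, by positivity, mul_div_cancel₀ _ hε.ne'⟩
  have hTS : (fun _ => T) ∈ S := by
    rw [key _ (fun _ => hT)]
    refine ⟨by nlinarith [mul_nonneg hsum hδ.le], fun i => ?_⟩
    have h1 : C₂ i ≤ ∑ i, C₂ i :=
      Finset.single_le_sum (f := C₂) (fun i _ => hC₂ i) (Finset.mem_univ i)
    have h2 : C₂ i * δ + δ ≤ ε * T := by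
      rw [hTC]
      nlinarith [mul_le_mul_of_nonneg_right h1 hδ.le, mul_pos hC₁ hδ]
    nlinarith [mul_le_mul_of_nonneg_right h2 hT.le]
  obtain ⟨Q, hQ⟩ : ∃ Q : ℝ, Q = (p : ℝ) + ∑ i, (q i : ℝ) := ⟨_, rfl⟩
  have hp' : (1 : ℝ) ≤ p := by exact_mod_cast hp
  have hq' : ∀ i, (1 : ℝ) ≤ q i := fun i => by exact_mod_cast hq i
  have hQ1 : 1 ≤ Q := by
    have : (0 : ℝ) ≤ ∑ i, (q i : ℝ) := Finset.sum_nonneg fun i _ => by positivity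
    linarith
  have hRpos : 0 < Q * T := by positivity
  have hden : ∀ b : Fin (m + 1) → ℝ, 0 ≤ Finset.univ.inf' Finset.univ_nonempty
      (fun i : Fin (m + 1) => (b i) ^ 2) := fun b =>
    Finset.le_inf' _ _ fun i _ => sq_nonneg _
  have hcont : Continuous f := by
    have : f = fun b => _ := funext hf
    rw [this]
    refine Continuous.div (by fun_prop) ?_ ?_
    · refine continuous_const.add (continuous_const.mul ?_)
      exact Continuous.finset_inf'_apply _ fun i _ => by fun_prop
    · intro b
      have := hden b
      positivity
  have hfT : f (fun _ => T) = Q * T ^ 2 / (γ + 2 * T ^ 2) := by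
    rw [hf]
    simp only [Finset.inf'_const]
    rw [hQ, ← Finset.sum_mul, add_mul]
  let K : Set (Fin (m + 1) → ℝ) := Set.Icc (fun _ => c) (fun _ => Q * T) ∩
    {b | C₁ * δ ≤ ε * b 0 ∧
      ∀ i : Fin m, C₂ i * δ * b i.succ + δ * b 0 ≤ ε * (b 0 * b i.succ)}
  have hKc : IsCompact K := by
    refine isCompact_Icc.inter_right (IsClosed.inter ?_ ?_)
    · change IsClosed {b : Fin (m + 1) → ℝ | C₁ * δ ≤ ε * b 0}
      exact isClosed_le (by fun_prop) (by fun_prop)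
    · have : {b : Fin (m + 1) → ℝ | ∀ i : Fin m, C₂ i * δ * b i.succ + δ * b 0 ≤
          ε * (b 0 * b i.succ)} = ⋂ i : Fin m, {b : Fin (m + 1) → ℝ |
          C₂ i * δ * b i.succ + δ * b 0 ≤ ε * (b 0 * b i.succ)} := by
        ext b; simp
      change IsClosed {b : Fin (m + 1) → ℝ | ∀ i : Fin m, C₂ i * δ * b i.succ + δ * b 0 ≤
          ε * (b 0 * b i.succ)}
      rw [this]
      exact isClosed_iInter fun i => isClosed_le (by fun_prop) (by fun_prop)
  have hSK : ∀ b ∈ S, (∀ i, b i ≤ Q * T) → b ∈ K := fun b hb hbR =>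
    ⟨⟨low b hb, hbR⟩, (key b fun i => hc.trans_le (low b hb i)).1 hb⟩
  have hTK : (fun _ => T) ∈ K := hSK _ hTS fun _ => by nlinarith
  obtain ⟨x, hxK, hx⟩ := hKc.exists_isMinOn ⟨_, hTK⟩ hcont.continuousOn
  refine ⟨x, (key x fun i => hc.trans_le (hxK.1.1 i)).2 hxK.2, ?_, Q * T, hRpos, hxK.1.2⟩
  intro b hb
  by_cases hbR : ∀ i, b i ≤ Q * T
  · exact hx (hSK b hb hbR)
  · push Not at hbR
    obtain ⟨j, hj⟩ := hbR
    refine (hx hTK : f x ≤ f _).trans ?_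
    rw [hfT, hf]
    have hμ := hden b
    have hle : ∀ i, Finset.univ.inf' Finset.univ_nonempty
      (fun i : Fin (m + 1) => (b i) ^ 2) ≤ (b i) ^ 2 := fun i =>
        Finset.inf'_le (fun i : Fin (m + 1) => (b i) ^ 2) (Finset.mem_univ i)
    generalize Finset.univ.inf' Finset.univ_nonempty
      (fun i : Fin (m + 1) => (b i) ^ 2) = μ at hμ hle ⊢
    have hN1 : Q * μ ≤ (p : ℝ) * (b 0) ^ 2 + ∑ i : Fin m, (q i : ℝ) * (b i.succ) ^ 2 := by
      rw [hQ, add_mul, Finset.sum_mul]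
      refine add_le_add (mul_le_mul_of_nonneg_left (hle 0) (by positivity))
        (Finset.sum_le_sum fun i _ => mul_le_mul_of_nonneg_left (hle _) (by positivity))
    have hN2 : (b j) ^ 2 ≤ (p : ℝ) * (b 0) ^ 2 + ∑ i : Fin m, (q i : ℝ) * (b i.succ) ^ 2 := by
      have hs : 0 ≤ ∑ i : Fin m, (q i : ℝ) * (b i.succ) ^ 2 :=
        Finset.sum_nonneg fun i _ => by positivity
      clear hj
      refine Fin.cases ?_ (fun i => ?_) j
      · nlinarith [sq_nonneg (b 0)]
      · have := Finset.single_le_sum (f := fun i : Fin m => (q i : ℝ) * (b i.succ) ^ 2)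
          (fun i _ => by positivity) (Finset.mem_univ i)
        nlinarith [sq_nonneg (b i.succ), hq' i, sq_nonneg (b 0)]
    have hN3 : Q * T ^ 2 ≤ (b j) ^ 2 := by
      have h1 : (Q * T) ^ 2 ≤ (b j) ^ 2 := pow_le_pow_left₀ hRpos.le hj.le 2
      have h2 : 0 ≤ (Q - 1) * (Q * T ^ 2) := mul_nonneg (by linarith) (by positivity)
      nlinarith
    have hN4 := hN3.trans hN2
    generalize (p : ℝ) * (b 0) ^ 2 + ∑ i : Fin m, (q i : ℝ) * (b i.succ) ^ 2 = N at hN1 hN4 ⊢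
    rw [div_le_div_iff₀ (by positivity) (by positivity)]
    nlinarith [mul_le_mul_of_nonneg_right hN4 hγ.le,
      mul_le_mul_of_nonneg_right hN1 (sq_nonneg T)]
end
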